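/- arXiv:0811.2475 — 3 statements merged into one kernel-verified Lean document; each statement's English description precedes it below -/
import Mathlib

section
/- Let (X, R) be a symmetric association scheme with n classes that is cometric with respect to the ordering E_0, …, E_n, and let Y ⊆ X with 1 < |Y| < |X|, with dual distance δ* and degree s. If δ* ≥ 2s − 1, then (Y, R^Y) is a cometric subscheme with s classes. -/
open Matrix BigOperators
open scoped ComplexOrder

namespace AssocScheme

variable (X : Type*) [Fintype X] [DecidableEq X]

/-- A commutative association scheme with `n` classes on a finite set `X`:
adjacency matrices `A 0, …, A n`, primitive idempotents `E 0, …, E n`,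
and intersection numbers `p`. -/
structure Scheme (n : ℕ) where
  A : Fin (n + 1) → Matrix X X ℂ
  E : Fin (n + 1) → Matrix X X ℂ
  p : Fin (n + 1) → Fin (n + 1) → Fin (n + 1) → ℂ
  A_zeroOne : ∀ i x y, A i x y = 0 ∨ A i x y = 1
  A_zero : A 0 = 1
  A_sum : ∑ i, A i = Matrix.of fun _ _ => (1 : ℂ)
  A_trans : ∀ i, ∃ i', (A i)ᵀ = A i'
  A_mul : ∀ i j, A i * A j = ∑ k, p i j k • A k
  A_comm : ∀ i j, A i * A j = A j * A i
  E_zero : E 0 = (Fintype.card X : ℂ)⁻¹ • Matrix.of fun _ _ => (1 : ℂ)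
  E_ne : ∀ i, E i ≠ 0
  E_herm : ∀ i, (E i).IsHermitian
  E_mul : ∀ i j, E i * E j = if i = j then E i else 0
  E_sum : ∑ i, E i = 1
  E_span : ∀ i, E i ∈ Submodule.span ℂ (Set.range A)

variable {X}
variable {n : ℕ}

/-- The scheme is symmetric: all adjacency matrices are symmetric. -/
def Scheme.IsSym (S : Scheme X n) : Prop := ∀ i, (S.A i)ᵀ = S.A i

/-- `P` is the first eigenmatrix. -/
def Scheme.IsP (S : Scheme X n) (P : Matrix (Fin (n + 1)) (Fin (n + 1)) ℂ) : Prop :=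
  ∀ i, S.A i = ∑ j, P j i • S.E j

/-- `Q` is the second eigenmatrix. -/
def Scheme.IsQ (S : Scheme X n) (Q : Matrix (Fin (n + 1)) (Fin (n + 1)) ℂ) : Prop :=
  ∀ i, S.E i = (Fintype.card X : ℂ)⁻¹ • ∑ j, Q j i • S.A j

/-- `q` is the family of Krein parameters of the scheme. -/
def Scheme.IsKrein (S : Scheme X n) (q : Fin (n + 1) → Fin (n + 1) → Fin (n + 1) → ℂ) : Prop :=
  ∀ i j, Matrix.hadamard (S.E i) (S.E j) = (Fintype.card X : ℂ)⁻¹ • ∑ k, q i j k • S.E k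

/-- The scheme is metric (P-polynomial) w.r.t. the given ordering of the `A i`. -/
def Scheme.Metric (S : Scheme X n) : Prop :=
  ∀ i j k : Fin (n + 1), ((i : ℕ) + (j : ℕ) < (k : ℕ) → S.p i j k = 0) ∧
    ((k : ℕ) = (i : ℕ) + (j : ℕ) → S.p i j k ≠ 0)

/-- The scheme is cometric (Q-polynomial) w.r.t. the given ordering of the `E i`,
with Krein parameters `q`. -/
def Scheme.Cometric (S : Scheme X n) (q : Fin (n + 1) → Fin (n + 1) → Fin (n + 1) → ℂ) : Prop :=
  S.IsKrein q ∧ ∀ i j k : Fin (n + 1), ((i : ℕ) + (j : ℕ) < (k : ℕ) → q i j k = 0) ∧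
    ((k : ℕ) = (i : ℕ) + (j : ℕ) → q i j k ≠ 0)

/-- The scheme is imprimitive: some nontrivial relation is disconnected. -/
def Scheme.Imprimitive (S : Scheme X n) : Prop :=
  ∃ i : Fin (n + 1), i ≠ 0 ∧ ¬ ∀ x y : X, Relation.EqvGen (fun a b => S.A i a b = 1) x y

/-- The inner distribution of a subset `Y`. -/
noncomputable def innerDist (S : Scheme X n) (Y : Finset X) : Fin (n + 1) → ℂ :=
  fun i => (Y.card : ℂ)⁻¹ * ∑ x ∈ Y, ∑ y ∈ Y, S.A i x y

/-- The MacWilliams transform `aQ` of a vector `a`. -/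
noncomputable def macT (Q : Matrix (Fin (n + 1)) (Fin (n + 1)) ℂ) (a : Fin (n + 1) → ℂ) : Fin (n + 1) → ℂ :=
  fun i => ∑ j, a j * Q j i

/-- Entry `B_{x,i}` of the outer distribution of `Y`. -/
noncomputable def outerB (S : Scheme X n) (Y : Finset X) (x : X) (i : Fin (n + 1)) : ℂ :=
  ∑ y ∈ Y, S.A i x y

open Fin.NatCast in
/-- `Y` is completely regular: row `x` of the outer distribution depends only on
`min{j : B_{x,j} ≠ 0}`. -/
def CompletelyRegular (S : Scheme X n) (Y : Finset X) : Prop :=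
  ∀ x x' : X,
    sInf {j : ℕ | outerB S Y x (j : Fin (n + 1)) ≠ 0} =
      sInf {j : ℕ | outerB S Y x' (j : Fin (n + 1)) ≠ 0} →
    ∀ i, outerB S Y x i = outerB S Y x' i

/-- `Y` is regular: `(A_i χ)_x = a_i` for all `x ∈ Y`. -/
def Regular (S : Scheme X n) (Y : Finset X) : Prop :=
  ∀ x ∈ Y, ∀ i, outerB S Y x i = innerDist S Y i

/-- The restriction of the scheme to `Y` (on the `s+1` relations meeting `Y`)
is a symmetric association scheme with `s` classes which is cometric with respect
to some ordering of its primitive idempotents. -/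
def CometricSubscheme (S : Scheme X n) (Y : Finset X) (s : ℕ) : Prop :=
  ∃ f : Fin (s + 1) → Fin (n + 1), Function.Injective f ∧
    (∀ j, f j = 0 ∨ innerDist S Y (f j) ≠ 0) ∧
    (∀ i : Fin (n + 1), (i = 0 ∨ innerDist S Y i ≠ 0) → ∃ j, f j = i) ∧
    ∃ (S' : Scheme {x // x ∈ Y} s) (q' : Fin (s + 1) → Fin (s + 1) → Fin (s + 1) → ℂ),
      (∀ j (y y' : {x // x ∈ Y}), S'.A j y y' = S.A (f j) y.1 y'.1) ∧
      S'.IsSym ∧ S'.Cometric q'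

end AssocScheme

namespace AssocScheme

open Polynomial in
/-- Triangular expansion in a degree-graded family of polynomials. -/
theorem expand_aux {s : ℕ} (G : Fin (s + 1) → ℂ[X]) (hG : ∀ i, (G i).degree = ((i : ℕ) : WithBot ℕ)) :
    ∀ (d : ℕ), d ≤ s + 1 → ∀ p : ℂ[X], p.degree < (d : WithBot ℕ) →
      ∃ c : Fin (s + 1) → ℂ, p = ∑ k, c k • G k ∧ ∀ k : Fin (s + 1), d ≤ (k : ℕ) → c k = 0 := by
  intro d
  induction d with
  | zero =>
    intro _ p hp
    have : p = 0 := by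
      rw [← Polynomial.degree_eq_bot]
      simpa [Nat.WithBot.lt_zero_iff] using hp
    exact ⟨fun _ => 0, by simp [this], by simp⟩
  | succ d ih =>
    intro hd p hp
    have hds : d < s + 1 := by omega
    let a : ℂ := p.coeff d / (G ⟨d, hds⟩).leadingCoeff
    have hlc : (G ⟨d, hds⟩).leadingCoeff ≠ 0 := by
      intro h
      rw [Polynomial.leadingCoeff_eq_zero] at h
      have := hG ⟨d, hds⟩
      simp [h] at this
    have hnd : (G ⟨d, hds⟩).natDegree = d := Polynomial.natDegree_eq_of_degree_eq_some (hG ⟨d, hds⟩)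
    obtain ⟨c, hc, hc0⟩ := ih (by omega) (p - a • G ⟨d, hds⟩) (by
      rw [Polynomial.degree_lt_iff_coeff_zero]
      intro m hm
      rcases Nat.eq_or_lt_of_le hm with h | h
      · subst h
        have : (G ⟨d, hds⟩).coeff d = (G ⟨d, hds⟩).leadingCoeff := by
          rw [Polynomial.leadingCoeff, hnd]
        simp only [Polynomial.coeff_sub, Polynomial.coeff_smul, smul_eq_mul, this, a]
        field_simp
        simp
      · have h1 : p.coeff m = 0 := Polynomial.coeff_eq_zero_of_degree_lt
          (lt_of_lt_of_le hp (by exact_mod_cast h))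
        have h2 : (G ⟨d, hds⟩).coeff m = 0 := Polynomial.coeff_eq_zero_of_degree_lt
          (by rw [hG]; exact_mod_cast h)
        simp [h1, h2])
    refine ⟨fun k => c k + (if k = ⟨d, hds⟩ then a else 0), ?_, ?_⟩
    · simp only [add_smul, Finset.sum_add_distrib, ← hc, ite_smul, zero_smul, Finset.sum_ite_eq',
        Finset.mem_univ, if_true]
      ring
    · intro k hk
      have h1 := hc0 k (by omega)
      have h2 : k ≠ ⟨d, hds⟩ := by
        intro h; subst h; simp at hk
      simp [h1, h2]

open Polynomial in
theorem expand {s : ℕ} (G : Fin (s + 1) → ℂ[X]) (hG : ∀ i, (G i).degree = ((i : ℕ) : WithBot ℕ))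
    (p : ℂ[X]) (d : ℕ) (hd : d ≤ s) (hp : p.degree = (d : WithBot ℕ)) :
    ∃ c : Fin (s + 1) → ℂ, p = ∑ k, c k • G k ∧ ∀ k : Fin (s + 1),
      (d < (k : ℕ) → c k = 0) ∧ ((k : ℕ) = d → c k ≠ 0) := by
  obtain ⟨c, hc, hc0⟩ := expand_aux G hG (d + 1) (by omega) p (by rw [hp]; exact_mod_cast Nat.lt_succ_self d)
  refine ⟨c, hc, fun k => ⟨fun h => hc0 k h, ?_⟩⟩
  intro hk h0
  have : p.degree < (d : WithBot ℕ) := by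
    rw [hc, Polynomial.degree_lt_iff_coeff_zero]
    intro m hm
    rw [Polynomial.finsetSum_coeff]
    refine Finset.sum_eq_zero fun j _ => ?_
    rw [Polynomial.coeff_smul]
    by_cases hj : (j : ℕ) < d
    · rw [Polynomial.coeff_eq_zero_of_degree_lt, smul_zero]
      rw [hG]; exact_mod_cast lt_of_lt_of_le hj hm
    · rcases Nat.eq_or_lt_of_le (not_lt.1 hj) with h | h
      · have : j = k := Fin.ext (by omega)
        rw [this, h0, zero_smul]
      · rw [hc0 j h, zero_smul]
  rw [hp] at this
  exact lt_irrefl _ this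

theorem unique_rel {Z ι : Type*} [Fintype ι] [DecidableEq ι] (B : ι → Matrix Z Z ℂ)
    (h01 : ∀ i x y, B i x y = 0 ∨ B i x y = 1)
    (hsum : ∑ i, B i = Matrix.of fun _ _ => (1 : ℂ)) (x y : Z) :
    ∃ j, ∀ i, B i x y = if i = j then 1 else 0 := by
  have h := congrFun (congrFun hsum x) y
  rw [Matrix.sum_apply] at h
  simp only [Matrix.of_apply] at h
  have h2 : ∑ i, B i x y = (((Finset.univ.filter fun i => B i x y = 1).card : ℕ) : ℂ) := by
    rw [Finset.card_filter]
    push_cast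
    refine Finset.sum_congr rfl fun i _ => ?_
    rcases h01 i x y with h | h <;> simp [h]
  rw [h] at h2
  have h3 : (Finset.univ.filter fun i => B i x y = 1).card = 1 := by exact_mod_cast h2.symm
  obtain ⟨j, hj⟩ := Finset.card_eq_one.1 h3
  refine ⟨j, fun i => ?_⟩
  have : B i x y = 1 ↔ i = j := by
    have h4 : i ∈ (Finset.univ.filter fun i => B i x y = 1) ↔ i ∈ ({j} : Finset ι) := by rw [hj]
    simpa using h4
  split_ifs with hi
  · exact this.2 hi
  · exact (h01 i x y).resolve_right (fun h => hi (this.1 h))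

open Polynomial in
theorem build {Z : Type*} [Fintype Z] [DecidableEq Z] {s : ℕ} (hs : 1 ≤ s)
    (hZ : (Fintype.card Z : ℂ) ≠ 0)
    (B : Fin (s + 1) → Matrix Z Z ℂ) (h01 : ∀ i x y, B i x y = 0 ∨ B i x y = 1)
    (hB0 : B 0 = 1) (hsum : ∑ i, B i = Matrix.of fun _ _ => (1 : ℂ))
    (hsym : ∀ i, (B i)ᵀ = B i) (hne : ∀ i, ∃ x y, B i x y = 1)
    (T : Matrix Z Z ℂ) (θ : Fin (s + 1) → ℂ) (hθ : Function.Injective θ)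
    (hT : ∀ j x y, B j x y = 1 → T x y = θ j)
    (g : Fin s → ℂ[X]) (hg : ∀ i, (g i).degree = ((i : ℕ) : WithBot ℕ))
    (F : Fin s → Matrix Z Z ℂ) (hF : ∀ i x y, F i x y = (g i).eval (T x y))
    (hFh : ∀ i, (F i).IsHermitian) (hFm : ∀ i j, F i * F j = if i = j then F i else 0)
    (hF0 : F ⟨0, hs⟩ = (Fintype.card Z : ℂ)⁻¹ • Matrix.of fun _ _ => (1 : ℂ)) :
    ∃ (S' : Scheme Z s) (q' : Fin (s + 1) → Fin (s + 1) → Fin (s + 1) → ℂ),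
      S'.A = B ∧ S'.Cometric q' := by
  let M : ℂ[X] →ₗ[ℂ] Matrix Z Z ℂ :=
    { toFun := fun p => Matrix.of fun x y => p.eval (T x y)
      map_add' := by intro p r; ext x y; simp
      map_smul' := by intro c p; ext x y; simp }
  have hMa : ∀ p x y, M p x y = p.eval (T x y) := fun p x y => rfl
  have hMB : ∀ p, M p = ∑ j, p.eval (θ j) • B j := by
    intro p
    ext x y
    obtain ⟨j, hj⟩ := unique_rel B h01 hsum x y
    rw [hMa, Matrix.sum_apply]
    simp only [Matrix.smul_apply, hj, smul_eq_mul, mul_ite, mul_one, mul_zero, Finset.sum_ite_eq',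
      Finset.mem_univ, if_true]
    rw [hT j x y (by simp [hj])]
  have hMne : ∀ p, M p = 0 → ∀ j, p.eval (θ j) = 0 := by
    intro p hp j
    obtain ⟨x, y, hxy⟩ := hne j
    have := congrFun (congrFun hp x) y
    rw [hMa, hT j x y hxy] at this
    simpa using this
  have hLb : ∀ j, M (Lagrange.basis Finset.univ θ j) = B j := by
    intro j
    rw [hMB, Finset.sum_eq_single j]
    · rw [Lagrange.eval_basis_self hθ.injOn (Finset.mem_univ _), one_smul]
    · intro k _ hk
      rw [Lagrange.eval_basis_of_ne hk.symm (Finset.mem_univ _), zero_smul]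
    · simp
  have hLd : ∀ j, (Lagrange.basis Finset.univ θ j).degree = (s : WithBot ℕ) := by
    intro j
    rw [Lagrange.degree_basis hθ.injOn (Finset.mem_univ _)]
    simp
  let G : Fin (s + 1) → ℂ[X] := Fin.snoc (α := fun _ => ℂ[X]) g (Lagrange.basis Finset.univ θ 0 - ∑ i, g i)
  have hGc : ∀ i : Fin s, G i.castSucc = g i := fun i => Fin.snoc_castSucc (α := fun _ => ℂ[X]) ..
  have hGl : G (Fin.last s) = Lagrange.basis Finset.univ θ 0 - ∑ i, g i := Fin.snoc_last (α := fun _ => ℂ[X]) ..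
  have hG : ∀ i, (G i).degree = ((i : ℕ) : WithBot ℕ) := by
    intro i
    refine Fin.lastCases ?_ (fun i => ?_) i
    · rw [hGl, Polynomial.degree_sub_eq_left_of_degree_lt, hLd]
      · simp
      · rw [hLd]
        rw [← Polynomial.mem_degreeLT]
        refine Submodule.sum_mem _ fun i _ => ?_
        rw [Polynomial.mem_degreeLT, hg]
        exact_mod_cast i.2
    · rw [hGc, hg]; simp
  have hMg : ∀ i, M (g i) = F i := by
    intro i; ext x y; rw [hMa, hF]
  let E : Fin (s + 1) → Matrix Z Z ℂ := fun i => M (G i)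
  have hEc : ∀ i : Fin s, E i.castSucc = F i := fun i => by simp only [E, hGc, hMg]
  have hEl : E (Fin.last s) = 1 - ∑ i, F i := by
    simp only [E, hGl, map_sub, map_sum, hMg, hLb, hB0]
  have hFS : ∀ i, F i * ∑ j, F j = F i := by
    intro i; rw [Finset.mul_sum]; simp [hFm]
  have hSF : ∀ i, (∑ j, F j) * F i = F i := by
    intro i; rw [Finset.sum_mul]; simp [hFm]
  have hSS : (∑ j, F j) * ∑ j, F j = ∑ j, F j := by
    rw [Finset.sum_mul]; simp [hFS]
  have hEmul : ∀ i j, E i * E j = if i = j then E i else 0 := by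
    intro i j
    refine Fin.lastCases ?_ (fun i => ?_) i <;> refine Fin.lastCases ?_ (fun j => ?_) j
    · rw [hEl, if_pos rfl, sub_mul, mul_sub, mul_sub, hSS]; simp
    · rw [hEl, hEc, sub_mul, hSF, if_neg (Fin.castSucc_lt_last j).ne']; simp
    · rw [hEl, hEc, mul_sub, hFS, if_neg (Fin.castSucc_lt_last i).ne]; simp
    · rw [hEc, hEc, hFm]; simp [Fin.castSucc_inj]
  have hEsum : ∑ i, E i = 1 := by
    rw [Fin.sum_univ_castSucc, hEl]; simp [hEc]
  -- every polynomial image expands in the `E`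
  have hBE : ∀ j, ∃ c : Fin (s + 1) → ℂ, B j = ∑ k, c k • E k := by
    intro j
    obtain ⟨c, hc, -⟩ := expand G hG _ s le_rfl (hLd j)
    refine ⟨c, ?_⟩
    rw [← hLb, hc]; simp [E]
  choose c hc using hBE
  have hEB : ∀ k, E k = ∑ j, (G k).eval (θ j) • B j := fun k => hMB _
  have hBB : ∀ i j, B i * B j = ∑ k, (c i k * c j k) • E k := by
    intro i j
    rw [hc i, hc j, Finset.sum_mul]
    refine Finset.sum_congr rfl fun k _ => ?_
    rw [Finset.mul_sum]
    simp [hEmul, smul_smul, mul_comm]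
  have hany : ∀ p : ℂ[X], ∃ d : Fin (s + 1) → ℂ, M p = ∑ k, d k • E k := by
    intro p
    refine ⟨fun k => ∑ j, p.eval (θ j) * c j k, ?_⟩
    rw [hMB]
    simp_rw [Finset.sum_smul]
    rw [Finset.sum_comm]
    refine Finset.sum_congr rfl fun j _ => ?_
    rw [hc j, Finset.smul_sum]
    simp [smul_smul]
  have hK : ∀ i j, ∃ r : Fin (s + 1) → ℂ, Matrix.hadamard (E i) (E j) =
      (Fintype.card Z : ℂ)⁻¹ • ∑ k, r k • E k ∧ ∀ k : Fin (s + 1),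
      ((i : ℕ) + (j : ℕ) < (k : ℕ) → r k = 0) ∧ ((k : ℕ) = (i : ℕ) + (j : ℕ) → r k ≠ 0) := by
    intro i j
    have hh : Matrix.hadamard (E i) (E j) = M (G i * G j) := by
      ext x y; simp [E, hMa, Matrix.hadamard]
    have hex : ∃ r : Fin (s + 1) → ℂ, M (G i * G j) = ∑ k, r k • E k ∧ ∀ k : Fin (s + 1),
      ((i : ℕ) + (j : ℕ) < (k : ℕ) → r k = 0) ∧ ((k : ℕ) = (i : ℕ) + (j : ℕ) → r k ≠ 0) := by
      by_cases hij : (i : ℕ) + (j : ℕ) ≤ s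
      · obtain ⟨r, hr, hr'⟩ := expand G hG (G i * G j) (i + j) hij (by
          rw [Polynomial.degree_mul, hG, hG]; push_cast; rfl)
        refine ⟨r, ?_, hr'⟩
        rw [hr]; simp [E]
      · obtain ⟨r, hr⟩ := hany (G i * G j)
        exact ⟨r, hr, fun k => ⟨fun h => by omega, fun h => by omega⟩⟩
    obtain ⟨r, hr, hr'⟩ := hex
    refine ⟨fun k => Fintype.card Z * r k, ?_, fun k => ⟨fun h => ?_, fun h => ?_⟩⟩
    · rw [hh, hr, Finset.smul_sum]
      refine Finset.sum_congr rfl fun k _ => ?_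
      rw [smul_smul, inv_mul_cancel_left₀ hZ]
    · simp [(hr' k).1 h]
    · exact mul_ne_zero hZ ((hr' k).2 h)
  choose q' hq1 hq2 using hK
  refine ⟨{ A := B, E := E, p := fun i j l => ∑ k, (c i k * c j k) * (G k).eval (θ l),
            A_zeroOne := h01, A_zero := hB0, A_sum := hsum, A_trans := fun i => ⟨i, hsym i⟩,
            A_mul := ?_, A_comm := ?_, E_zero := ?_, E_ne := ?_, E_herm := ?_, E_mul := hEmul,
            E_sum := hEsum, E_span := ?_ }, q', rfl, hq1, hq2⟩
  · intro i j
    rw [hBB]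
    simp_rw [Finset.sum_smul]
    rw [Finset.sum_comm]
    refine Finset.sum_congr rfl fun k _ => ?_
    rw [hEB k, Finset.smul_sum]
    simp [smul_smul]
  · intro i j
    rw [hBB, hBB]
    simp_rw [mul_comm]
  · have : (0 : Fin (s + 1)) = Fin.castSucc ⟨0, hs⟩ := rfl
    rw [this, hEc, hF0]
  · intro i h0
    have h := hMne (G i) h0
    have hz : G i = 0 := Polynomial.eq_zero_of_degree_lt_of_eval_index_eq_zero Finset.univ
      hθ.injOn (by rw [hG, Finset.card_univ, Fintype.card_fin]; exact_mod_cast i.2) (fun j _ => h j)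
    have := hG i
    simp [hz] at this
  · intro i
    refine Fin.lastCases ?_ (fun i => ?_) i
    · rw [hEl]
      refine Matrix.isHermitian_one.sub ?_
      rw [Matrix.IsHermitian, Matrix.conjTranspose_sum]
      exact Finset.sum_congr rfl fun i _ => hFh i
    · rw [hEc]; exact hFh i
  · intro i
    rw [hEB]
    exact Submodule.sum_mem _ fun j _ => Submodule.smul_mem _ _ (Submodule.subset_span ⟨j, rfl⟩)

section host
variable {X : Type*} [Fintype X] [DecidableEq X] {n : ℕ}

theorem A_mem_spanE (S : Scheme X n) (i : Fin (n + 1)) :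
    S.A i ∈ Submodule.span ℂ (Set.range S.E) := by
  have hli : LinearIndependent ℂ S.E := by
    rw [Fintype.linearIndependent_iff]
    intro c hc j
    have h := congrArg (fun m => m * S.E j) hc
    simp only [Finset.sum_mul, smul_mul_assoc, S.E_mul, smul_ite, smul_zero, Finset.sum_ite_eq',
      Finset.mem_univ, if_true, zero_mul] at h
    exact (smul_eq_zero.1 h).resolve_right (S.E_ne j)
  have hle : Submodule.span ℂ (Set.range S.E) ≤ Submodule.span ℂ (Set.range S.A) :=
    Submodule.span_le.2 (by rintro _ ⟨i, rfl⟩; exact S.E_span i)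
  have := Submodule.eq_of_le_of_finrank_le hle (by
    rw [finrank_span_eq_card hli]
    exact finrank_range_le_card S.A)
  rw [this]
  exact Submodule.subset_span ⟨i, rfl⟩

theorem E_symm (S : Scheme X n) (hsym : S.IsSym) (i : Fin (n + 1)) : (S.E i)ᵀ = S.E i := by
  have h := S.E_span i
  generalize S.E i = m at h ⊢
  induction h using Submodule.span_induction with
  | mem x hx => obtain ⟨j, rfl⟩ := hx; exact hsym j
  | zero => simp
  | add x y _ _ hx hy => rw [Matrix.transpose_add, hx, hy]
  | smul a x _ hx => rw [Matrix.transpose_smul, hx]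

open Polynomial in
theorem E_poly [Nonempty X] (hn : 1 ≤ n) (S : Scheme X n)
    (q : Fin (n + 1) → Fin (n + 1) → Fin (n + 1) → ℂ) (hcom : S.Cometric q) :
    ∀ (i : ℕ) (hi : i < n + 1), ∃ v : ℂ[X], v.degree = (i : WithBot ℕ) ∧
      ∀ x y, S.E ⟨i, hi⟩ x y = v.eval (S.E ⟨1, by omega⟩ x y) := by
  have hX : (Fintype.card X : ℂ) ≠ 0 := by exact_mod_cast Fintype.card_ne_zero
  intro i
  induction i using Nat.strong_induction_on with
  | _ i ih =>
  intro hi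
  rcases i with _ | i
  · refine ⟨C (Fintype.card X : ℂ)⁻¹, Polynomial.degree_C (inv_ne_zero hX), fun x y => ?_⟩
    have : (⟨0, hi⟩ : Fin (n + 1)) = 0 := rfl
    rw [this, S.E_zero]; simp
  · rcases i with _ | i
    · exact ⟨Polynomial.X, by simp, fun x y => by simp⟩
    · choose! v hv1 hv2 using ih
      let e : Fin (n + 1) := ⟨1, by omega⟩
      let j : Fin (n + 1) := ⟨i + 1, by omega⟩
      let l : Fin (n + 1) := ⟨i + 2, hi⟩
      have hql : q e j l ≠ 0 := (hcom.2 e j l).2 (by simp [e, j, l]; omega)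
      let N : ℂ := Fintype.card X
      have hN : N ≠ 0 := hX
      let w : ℂ[X] := ∑ k ∈ Finset.univ.filter (fun k : Fin (n + 1) => (k : ℕ) < i + 2),
        (q e j k) • v k
      refine ⟨(q e j l)⁻¹ • (N • (Polynomial.X * v (i + 1)) - w), ?_, ?_⟩
      · have h1 : (N • (Polynomial.X * v (i + 1))).degree = ((i + 1 + 1 : ℕ) : WithBot ℕ) := by
          rw [Polynomial.degree_smul_of_smul_regular _ (IsSMulRegular.of_ne_zero hN),
            Polynomial.degree_mul, Polynomial.degree_X, hv1 (i + 1) (by omega) (by omega)]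
          push_cast; ring
        have h2 : w.degree < ((i + 1 + 1 : ℕ) : WithBot ℕ) := by
          rw [← Polynomial.mem_degreeLT]
          refine Submodule.sum_mem _ fun k hk => Submodule.smul_mem _ _ ?_
          have hk' : (k : ℕ) < i + 2 := by simpa using hk
          rw [Polynomial.mem_degreeLT, hv1 k hk' k.2]
          exact_mod_cast hk'
        rw [Polynomial.degree_smul_of_smul_regular _ (IsSMulRegular.of_ne_zero (inv_ne_zero hql)),
          Polynomial.degree_sub_eq_left_of_degree_lt (by rw [h1]; exact h2), h1]
      · intro x y
        have h := congrFun (congrFun (hcom.1 e j) x) y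
        have hsplit : ∑ k, q e j k * S.E k x y = q e j l * S.E l x y +
            w.eval (S.E e x y) := by
          rw [← Finset.sum_filter_add_sum_filter_not Finset.univ (fun k : Fin (n + 1) => (k : ℕ) < i + 2),
            add_comm]
          congr 1
          · rw [Finset.sum_eq_single l]
            · intro k hk hkl
              have hk' : ¬ (k : ℕ) < i + 2 := by simpa using hk
              have : (k : ℕ) ≠ i + 2 := fun h => hkl (Fin.ext h)
              rw [(hcom.2 e j k).1 (by simp only [e, j]; omega), zero_mul]
            · intro h; simp [l] at h
          · rw [Polynomial.eval_finsetSum]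
            refine Finset.sum_congr rfl fun k hk => ?_
            have hk' : (k : ℕ) < i + 2 := by simpa using hk
            have := hv2 k hk' k.2 x y
            rw [Polynomial.eval_smul, smul_eq_mul, ← this]
        rw [Matrix.hadamard_apply, Matrix.smul_apply, Matrix.sum_apply] at h
        simp only [Matrix.smul_apply, smul_eq_mul] at h
        rw [hsplit] at h
        have hj := hv2 (i + 1) (by omega) (by omega) x y
        have hj' : S.E j x y = (v (i + 1)).eval (S.E e x y) := hj
        rw [hj'] at h
        change S.E l x y = ((q e j l)⁻¹ • (N • (Polynomial.X * v (i + 1)) - w)).eval (S.E e x y)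
        simp only [Polynomial.eval_smul, Polynomial.eval_sub, Polynomial.eval_mul,
          Polynomial.eval_X, smul_eq_mul, h]
        change S.E l x y = (q e j l)⁻¹ * (N * (N⁻¹ * (q e j l * S.E l x y + w.eval (S.E e x y))) -
          w.eval (S.E e x y))
        field_simp
        ring

/-- Entries of `E 1` separate the relations. -/
theorem sep [Nonempty X] (hn : 1 ≤ n) (S : Scheme X n)
    (q : Fin (n + 1) → Fin (n + 1) → Fin (n + 1) → ℂ) (hcom : S.Cometric q)
    (i j : Fin (n + 1)) (x y x' y' : X) (hi : S.A i x y = 1) (hj : S.A j x' y' = 1)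
    (h : S.E ⟨1, by omega⟩ x y = S.E ⟨1, by omega⟩ x' y') : i = j := by
  have hA : S.A i x y = S.A i x' y' := by
    have hm := A_mem_spanE S i
    generalize S.A i = m at hm
    induction hm using Submodule.span_induction with
    | mem m hm =>
      obtain ⟨k, rfl⟩ := hm
      obtain ⟨v, -, hv⟩ := E_poly hn S q hcom k k.2
      have h1 := hv x y
      have h2 := hv x' y'
      rw [h, ← h2] at h1
      exact h1
    | zero => simp
    | add a b _ _ ha hb => simp [ha, hb]
    | smul a b _ hb => simp [hb]
  obtain ⟨k, hk⟩ := unique_rel S.A S.A_zeroOne S.A_sum x' y'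
  rw [hi, hk i] at hA
  rw [hk j] at hj
  have h1 : i = k := by by_contra h; simp [h] at hA
  have h2 : j = k := by by_contra h; simp [h] at hj
  rw [h1, h2]

theorem orth (S : Scheme X n) (hsym : S.IsSym)
    (q : Fin (n + 1) → Fin (n + 1) → Fin (n + 1) → ℂ) (hcom : S.Cometric q)
    (v : X → ℂ) (i j : Fin (n + 1))
    (hv : ∀ k : Fin (n + 1), (k : ℕ) ≤ i + j → S.E k *ᵥ v = 0) :
    S.E i * Matrix.diagonal v * S.E j = 0 := by
  rw [← Matrix.trace_conjTranspose_mul_self_eq_zero_iff]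
  have h1 : (S.E i * Matrix.diagonal v * S.E j)ᴴ * (S.E i * Matrix.diagonal v * S.E j)
      = S.E j * (Matrix.diagonal (star v) * S.E i * Matrix.diagonal v * S.E j) := by
    simp only [Matrix.conjTranspose_mul, (S.E_herm _).eq, Matrix.diagonal_conjTranspose]
    have := S.E_mul i i
    rw [if_pos rfl] at this
    simp only [Matrix.mul_assoc]
    rw [← Matrix.mul_assoc (S.E i) (S.E i), this]
  have h2 : S.E j * S.E j = S.E j := by simpa using S.E_mul j j
  rw [h1, Matrix.trace_mul_comm, Matrix.mul_assoc, h2]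
  have h3 : (Matrix.diagonal (star v) * S.E i * Matrix.diagonal v * S.E j).trace =
      star v ⬝ᵥ (Matrix.hadamard (S.E i) (S.E j) *ᵥ v) := by
    simp only [Matrix.trace, Matrix.diag_apply, Matrix.mul_apply (N := S.E j), dotProduct,
      Matrix.mulVec, Finset.mul_sum, Matrix.mul_diagonal, Matrix.diagonal_mul, Matrix.hadamard_apply]
    refine Finset.sum_congr rfl fun x _ => Finset.sum_congr rfl fun y _ => ?_
    have : S.E j y x = S.E j x y := congrFun (congrFun (E_symm S hsym j) x) y
    rw [this]; ring
  rw [h3, hcom.1 i j, Matrix.smul_mulVec, Matrix.sum_mulVec]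
  have : ∑ k, (q i j k • S.E k) *ᵥ v = 0 := by
    refine Finset.sum_eq_zero fun k _ => ?_
    rw [Matrix.smul_mulVec]
    by_cases hk : (k : ℕ) ≤ i + j
    · rw [hv k hk, smul_zero]
    · rw [(hcom.2 i j k).1 (by omega), zero_smul]
  rw [this]; simp

end host

theorem innerDist_eq_zero {X : Type*} [Fintype X] [DecidableEq X] {n : ℕ} (S : Scheme X n)
    (Y : Finset X) (hYc : (Y.card : ℂ) ≠ 0) (i : Fin (n + 1)) (h : innerDist S Y i = 0) :
    ∀ x ∈ Y, ∀ y ∈ Y, S.A i x y = 0 := by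
  have hnn : ∀ x y, 0 ≤ S.A i x y := by
    intro x y
    rcases S.A_zeroOne i x y with h | h <;> rw [h]
    exact zero_le_one
  have h1 := (mul_eq_zero.1 h).resolve_left (inv_ne_zero hYc)
  intro x hx y hy
  rw [Finset.sum_eq_zero_iff_of_nonneg (fun x _ => Finset.sum_nonneg fun y _ => hnn x y)] at h1
  have h2 := h1 x hx
  rw [Finset.sum_eq_zero_iff_of_nonneg (fun y _ => hnn x y)] at h2
  exact h2 y hy

theorem E_mulVec_eq_zero {X : Type*} [Fintype X] [DecidableEq X] [Nonempty X] {n : ℕ}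
    (S : Scheme X n)
    (Q : Matrix (Fin (n + 1)) (Fin (n + 1)) ℂ) (hQ : S.IsQ Q)
    (Y : Finset X) (k : Fin (n + 1)) (hYc : (Y.card : ℂ) ≠ 0)
    (h : macT Q (innerDist S Y) k = 0) :
    S.E k *ᵥ (fun x => if x ∈ Y then (1 : ℂ) else 0) = 0 := by
  have hX : (Fintype.card X : ℂ) ≠ 0 := by exact_mod_cast Fintype.card_ne_zero
  have hsumE : ∑ x ∈ Y, ∑ y ∈ Y, S.E k x y = 0 := by
    have h1 : macT Q (innerDist S Y) k =
        (Y.card : ℂ)⁻¹ * (Fintype.card X * ∑ x ∈ Y, ∑ y ∈ Y, S.E k x y) := by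
      unfold macT innerDist
      have h2 : ∀ x y, S.E k x y = (Fintype.card X : ℂ)⁻¹ * ∑ j, Q j k * S.A j x y := by
        intro x y
        rw [hQ k, Matrix.smul_apply, Matrix.sum_apply]
        simp
      simp_rw [h2, ← Finset.mul_sum]
      rw [mul_inv_cancel_left₀ hX]
      have h3 : ∑ x ∈ Y, ∑ y ∈ Y, ∑ j, Q j k * S.A j x y =
          ∑ j, Q j k * ∑ x ∈ Y, ∑ y ∈ Y, S.A j x y := by
        simp_rw [Finset.mul_sum]
        rw [Finset.sum_comm]
        rw [Finset.sum_comm, Finset.sum_comm (s := Finset.univ)]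
        refine Finset.sum_congr rfl fun x _ => ?_
        rw [Finset.sum_comm]
      rw [h3, Finset.mul_sum]
      exact Finset.sum_congr rfl fun j _ => by ring
    rw [h1] at h
    exact (mul_eq_zero.1 ((mul_eq_zero.1 h).resolve_left (inv_ne_zero hYc))).resolve_left hX
  set χ : X → ℂ := fun x => if x ∈ Y then (1 : ℂ) else 0 with hχ
  rw [← _root_.dotProduct_star_self_eq_zero, Matrix.star_mulVec, (S.E_herm k).eq,
    ← Matrix.dotProduct_mulVec, Matrix.mulVec_mulVec, S.E_mul, if_pos rfl]
  have : star χ = χ := by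
    ext x; simp only [hχ, Pi.star_apply]; split_ifs <;> simp
  rw [this]
  simp only [dotProduct, Matrix.mulVec, hχ, mul_ite, mul_one, mul_zero, ite_mul, one_mul, zero_mul]
  refine Eq.trans ?_ hsumE
  simp only [Finset.sum_ite_mem, Finset.univ_inter]

/-- in a cometric scheme, a code with `δ* ≥ 2s − 1` induces a cometric
subscheme with `s` classes. -/
theorem dual_distance_ge_implies_cometric_subscheme {X : Type*} [Fintype X] [DecidableEq X]
    [Nonempty X] {n : ℕ} (hn : 1 ≤ n) (S : Scheme X n) (hsym : S.IsSym)
    (q : Fin (n + 1) → Fin (n + 1) → Fin (n + 1) → ℂ) (hcom : S.Cometric q)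
    (Q : Matrix (Fin (n + 1)) (Fin (n + 1)) ℂ) (hQ : S.IsQ Q)
    (Y : Finset X) (hY1 : 1 < Y.card) (hY2 : Y.card < Fintype.card X)
    (δs : Fin (n + 1))
    (hδs : IsLeast {i : Fin (n + 1) | i ≠ 0 ∧ macT Q (innerDist S Y) i ≠ 0} δs)
    (hge : 2 * Nat.card {i : Fin (n + 1) | i ≠ 0 ∧ innerDist S Y i ≠ 0} - 1 ≤ (δs : ℕ)) :
    CometricSubscheme S Y (Nat.card {i : Fin (n + 1) | i ≠ 0 ∧ innerDist S Y i ≠ 0}) := by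
  classical
  have hX : (Fintype.card X : ℂ) ≠ 0 := by exact_mod_cast Fintype.card_ne_zero
  have hYc : (Y.card : ℂ) ≠ 0 := by
    have : Y.card ≠ 0 := by omega
    exact_mod_cast this
  obtain ⟨⟨hδ0, -⟩, hδmin⟩ := hδs
  have hEχ := E_mulVec_eq_zero S Q hQ Y
  have hlow : ∀ k : Fin (n + 1), k ≠ 0 → (k : ℕ) < δs → 
      S.E k *ᵥ (fun x => if x ∈ Y then (1 : ℂ) else 0) = 0 := by
    intro k hk0 hk
    refine hEχ k hYc ?_
    by_contra h
    have := hδmin ⟨hk0, h⟩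
    exact absurd (Fin.le_def.1 this) (by omega)
  have e : Fin (Nat.card {i : Fin (n + 1) | i ≠ 0 ∧ innerDist S Y i ≠ 0}) ≃
      {i : Fin (n + 1) | i ≠ 0 ∧ innerDist S Y i ≠ 0} := (Finite.equivFin _).symm
  have hs : 1 ≤ Nat.card {i : Fin (n + 1) | i ≠ 0 ∧ innerDist S Y i ≠ 0} := by
    obtain ⟨x, hx, y, hy, hxy⟩ := Finset.one_lt_card.1 hY1
    obtain ⟨j, hj⟩ := unique_rel S.A S.A_zeroOne S.A_sum x y
    have hj0 : j ≠ 0 := by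
      rintro rfl
      have := hj 0
      rw [S.A_zero, Matrix.one_apply_ne hxy] at this
      simp at this
    have hjD : innerDist S Y j ≠ 0 := by
      intro h
      have := innerDist_eq_zero S Y hYc j h x hx y hy
      simp [hj j] at this
    have : Nonempty {i : Fin (n + 1) | i ≠ 0 ∧ innerDist S Y i ≠ 0} := ⟨⟨j, hj0, hjD⟩⟩
    exact Nat.card_pos
  generalize Nat.card {i : Fin (n + 1) | i ≠ 0 ∧ innerDist S Y i ≠ 0} = s at *
  have hsn : ∀ i : Fin s, (i : ℕ) < n + 1 := by
    intro i
    have := i.2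
    have := δs.2
    omega
  have hd0 : innerDist S Y 0 ≠ 0 := by
    intro h
    obtain ⟨x, hx⟩ := Finset.card_pos.1 (by omega : 0 < Y.card)
    have := innerDist_eq_zero S Y hYc 0 h x hx x hx
    simp [S.A_zero] at this
  let f : Fin (s + 1) → Fin (n + 1) := Fin.cons 0 (fun i => (e i).1)
  have hf0 : f 0 = 0 := rfl
  have hfs : ∀ i : Fin s, f i.succ = (e i).1 := fun i => rfl
  have hfd : ∀ j, innerDist S Y (f j) ≠ 0 := by
    intro j
    refine Fin.cases hd0 (fun i => ?_) j
    exact (e i).2.2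
  have hfinj : Function.Injective f := by
    refine Fin.cons_injective_iff.2 ⟨?_, ?_⟩
    · rintro ⟨i, hi⟩
      exact (e i).2.1 hi
    · exact Subtype.val_injective.comp e.injective
  have hfsurj : ∀ i : Fin (n + 1), innerDist S Y i ≠ 0 → ∃ j, f j = i := by
    intro i hi
    by_cases h : i = 0
    · exact ⟨0, h.symm⟩
    · refine ⟨(e.symm ⟨i, h, hi⟩).succ, ?_⟩
      rw [hfs, Equiv.apply_symm_apply]
  have hwit : ∀ j, ∃ x y : {x // x ∈ Y}, S.A (f j) x.1 y.1 = 1 := by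
    intro j
    by_contra hcon
    push Not at hcon
    refine hfd j ?_
    unfold innerDist
    rw [Finset.sum_eq_zero, mul_zero]
    intro x hx
    refine Finset.sum_eq_zero fun y hy => ?_
    exact (S.A_zeroOne (f j) x y).resolve_right (hcon ⟨x, hx⟩ ⟨y, hy⟩)
  choose wx wy hw using hwit
  let e1 : Fin (n + 1) := ⟨1, by omega⟩
  choose v hv1 hv2 using E_poly hn S q hcom
  let r : ℂ := Fintype.card X / Y.card
  have hr : r ≠ 0 := div_ne_zero hX hYc
  obtain ⟨S', q', hA, hcom'⟩ := build (Z := {x // x ∈ Y}) (s := s) hs (by simpa using hYc)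
    (fun j => Matrix.of fun y y' => S.A (f j) y.1 y'.1)
    (fun i x y => S.A_zeroOne _ _ _)
    (by
      ext x y
      simp only [Matrix.of_apply]
      rw [hf0, S.A_zero, Matrix.one_apply, Matrix.one_apply]
      simp only [Subtype.ext_iff])
    (by
      ext x y
      rw [Matrix.sum_apply]
      simp only [Matrix.of_apply]
      have h := congrFun (congrFun S.A_sum x.1) y.1
      rw [Matrix.sum_apply] at h
      simp only [Matrix.of_apply] at h
      rw [← h, ← Finset.sum_image (f := fun i => S.A i x.1 y.1) (g := f) hfinj.injOn]
      refine Finset.sum_subset (Finset.subset_univ _) fun i _ hi => ?_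
      refine innerDist_eq_zero S Y hYc i ?_ x.1 x.2 y.1 y.2
      by_contra h
      obtain ⟨j, hj⟩ := hfsurj i h
      exact hi (Finset.mem_image.2 ⟨j, Finset.mem_univ _, hj⟩))
    (fun i => by
      ext x y
      exact congrFun (congrFun (hsym (f i)) x.1) y.1)
    (fun i => ⟨wx i, wy i, hw i⟩)
    (Matrix.of fun y y' => S.E e1 y.1 y'.1)
    (fun j => S.E e1 (wx j).1 (wy j).1)
    (fun i j hij => hfinj (sep hn S q hcom _ _ _ _ _ _ (hw i) (hw j) hij))
    (fun j x y hxy => by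
      have hxy' : S.A (f j) x.1 y.1 = 1 := hxy
      have := hQ e1
      have h1 := unique_rel S.A S.A_zeroOne S.A_sum
      have key : ∀ a b : X, S.A (f j) a b = 1 → S.E e1 a b = (Fintype.card X : ℂ)⁻¹ * Q (f j) e1 := by
        intro a b hab
        obtain ⟨k, hk⟩ := h1 a b
        have hkj : k = f j := by
          by_contra h
          rw [hk, if_neg (Ne.symm h)] at hab
          exact zero_ne_one hab
        rw [this, Matrix.smul_apply, Matrix.sum_apply]
        simp [hk, hkj]
      simp only [Matrix.of_apply]
      rw [key _ _ hxy', key _ _ (hw j)])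
    (fun i => r • v i (hsn i))
    (fun i => by
      rw [Polynomial.degree_smul_of_smul_regular _ (IsSMulRegular.of_ne_zero hr), hv1])
    (fun i => Matrix.of fun y y' => r * S.E ⟨i, hsn i⟩ y.1 y'.1)
    (fun i x y => by
      simp only [Matrix.of_apply]
      rw [hv2, Polynomial.eval_smul, smul_eq_mul])
    (fun i => by
      ext x y
      have := congrFun (congrFun (S.E_herm ⟨i, hsn i⟩).eq x.1) y.1
      simp only [Matrix.conjTranspose_apply, Matrix.of_apply] at this ⊢
      rw [star_mul', this]
      simp [r])
    (fun i j => by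
      let w : X → ℂ := fun x => (if x ∈ Y then (1 : ℂ) else 0) - r⁻¹
      have hor := orth S hsym q hcom w ⟨i, hsn i⟩ ⟨j, hsn j⟩ (by
        intro k hk
        have hi := i.2
        have hj := j.2
        have hk' : (k : ℕ) ≤ i + j := hk
        have hsplit : w = (fun x => if x ∈ Y then (1 : ℂ) else 0) - r⁻¹ • (fun _ => (1 : ℂ)) := by
          ext x; simp [w]
        by_cases hk0 : k = 0
        · subst hk0
          rw [S.E_zero]
          ext x
          simp only [Matrix.mulVec, dotProduct, Matrix.smul_apply, Matrix.of_apply, smul_eq_mul,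
            mul_one, w, ← Finset.mul_sum, Finset.sum_sub_distrib, Pi.zero_apply]
          simp [r]
          field_simp
          simp
        · have h1 : S.E k *ᵥ (fun _ => (1 : ℂ)) = 0 := by
            have h2 := S.E_mul k 0
            rw [if_neg hk0, S.E_zero] at h2
            obtain ⟨y0⟩ := ‹Nonempty X›
            ext x
            have h3 := congrFun (congrFun h2 x) y0
            rw [Matrix.mul_smul, Matrix.smul_apply, smul_eq_mul, Matrix.zero_apply] at h3
            exact (mul_eq_zero.1 h3).resolve_left (inv_ne_zero hX)
          rw [hsplit, Matrix.mulVec_sub, Matrix.mulVec_smul, h1, hlow k hk0 (by omega)]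
          simp)
      ext y y'
      have h := congrFun (congrFun hor y.1) y'.1
      have hE := congrFun (congrFun (S.E_mul ⟨i, hsn i⟩ ⟨j, hsn j⟩) y.1) y'.1
      rw [Matrix.mul_apply] at h hE
      simp only [Matrix.mul_diagonal, w, Matrix.zero_apply, mul_sub, sub_mul,
        Finset.sum_sub_distrib] at h
      have h4 : ∑ x, S.E ⟨i, hsn i⟩ y.1 x * r⁻¹ * S.E ⟨j, hsn j⟩ x y'.1 =
          r⁻¹ * ∑ x, S.E ⟨i, hsn i⟩ y.1 x * S.E ⟨j, hsn j⟩ x y'.1 := by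
        rw [Finset.mul_sum]
        exact Finset.sum_congr rfl fun x _ => by ring
      have h5 : ∑ x, S.E ⟨i, hsn i⟩ y.1 x * (if x ∈ Y then (1 : ℂ) else 0) * S.E ⟨j, hsn j⟩ x y'.1 =
          ∑ z : {x // x ∈ Y}, S.E ⟨i, hsn i⟩ y.1 z.1 * S.E ⟨j, hsn j⟩ z.1 y'.1 := by
        rw [Finset.sum_coe_sort Y (fun x => S.E ⟨i, hsn i⟩ y.1 x * S.E ⟨j, hsn j⟩ x y'.1)]
        rw [← Finset.sum_filter_add_sum_filter_not Finset.univ (fun x => x ∈ Y)]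
        rw [Finset.sum_eq_zero (s := Finset.univ.filter (fun x => x ∉ Y)), add_zero]
        · rw [Finset.filter_mem_eq_inter, Finset.univ_inter]
          exact Finset.sum_congr rfl fun x hx => by simp [hx]
        · intro x hx
          have : x ∉ Y := by simpa using hx
          simp [this]
      rw [h4, h5, hE, sub_eq_zero] at h
      rw [Matrix.mul_apply]
      simp only [Matrix.of_apply]
      have h6 : ∑ z : {x // x ∈ Y}, r * S.E ⟨i, hsn i⟩ y.1 z.1 * (r * S.E ⟨j, hsn j⟩ z.1 y'.1) =
          r * r * ∑ z : {x // x ∈ Y}, S.E ⟨i, hsn i⟩ y.1 z.1 * S.E ⟨j, hsn j⟩ z.1 y'.1 := by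
        rw [Finset.mul_sum]
        exact Finset.sum_congr rfl fun x _ => by ring
      rw [h6, h]
      by_cases hij : i = j
      · subst hij
        simp
        field_simp
      · have : (⟨i, hsn i⟩ : Fin (n + 1)) ≠ ⟨j, hsn j⟩ := by
          intro h; exact hij (Fin.ext (by simpa using h))
        simp [hij, this])
    (by
      have h0 : (⟨0, hsn ⟨0, hs⟩⟩ : Fin (n + 1)) = 0 := rfl
      ext x y
      simp only [Matrix.of_apply, h0, S.E_zero, Matrix.smul_apply, smul_eq_mul, mul_one,
        Fintype.card_coe, r]
      field_simp)
  refine ⟨f, hfinj, fun j => Or.inr (hfd j), ?_, S', q', ?_, ?_, hcom'⟩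
  · rintro i (rfl | hi)
    · exact ⟨0, rfl⟩
    · exact hfsurj i hi
  · intro j y y'
    rw [hA]; rfl
  · intro j
    rw [hA]
    ext x y
    exact congrFun (congrFun (hsym (f j)) x.1) y.1

end AssocScheme
end

section
/- Let (X, R) be a symmetric association scheme with n classes that is metric with respect to the ordering A_0, …, A_n and cometric with respect to the ordering E_0, …, E_n. Then every subset Y ⊆ X with 1 < |Y| < |X| satisfies w + w* ≥ n, where w and w* are the width and dual width of Y. -/
open Matrix BigOperators
open scoped ComplexOrder

namespace AssocScheme

section helpers
variable {X : Type*} [Fintype X] [DecidableEq X] {n : ℕ} (S : Scheme X n)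

lemma A_nonneg (i : Fin (n + 1)) (x y : X) : 0 ≤ S.A i x y := by
  rcases S.A_zeroOne i x y with h | h <;> simp [h]

lemma A_exists (x y : X) : ∃ i, S.A i x y ≠ 0 := by
  by_contra! h
  have h1 := congrFun (congrFun S.A_sum x) y
  simp [Matrix.sum_apply, h] at h1

lemma A_unique {x y : X} {i j : Fin (n + 1)} (hi : S.A i x y ≠ 0) (hij : j ≠ i) :
    S.A j x y = 0 := by
  have h1 := congrFun (congrFun S.A_sum x) y
  rw [Matrix.sum_apply, ← Finset.add_sum_erase _ _ (Finset.mem_univ i)] at h1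
  have hi1 : S.A i x y = 1 := (S.A_zeroOne i x y).resolve_left hi
  simp only [hi1, Matrix.of_apply, add_eq_left] at h1
  rw [Finset.sum_eq_zero_iff_of_nonneg (fun k _ => A_nonneg S k x y)] at h1
  exact h1 j (by simp [hij])

lemma triangle (hmet : S.Metric) {x y z : X} {i j k : Fin (n + 1)} (hi : S.A i x z ≠ 0)
    (hj : S.A j z y ≠ 0) (hk : S.A k x y ≠ 0) : (k : ℕ) ≤ i + j := by
  by_contra! h
  have hp := (hmet i j k).1 h
  have h1 := congrFun (congrFun (S.A_mul i j) x) y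
  rw [Matrix.sum_apply, Finset.sum_eq_single k
    (fun b _ hb => by simp [A_unique S hk hb]) (by simp)] at h1
  rw [Matrix.smul_apply, hp, zero_smul, Matrix.mul_apply,
    Finset.sum_eq_zero_iff_of_nonneg
      (fun a _ => mul_nonneg (A_nonneg S _ _ _) (A_nonneg S _ _ _))] at h1
  exact mul_ne_zero hi hj (h1 z (Finset.mem_univ _))

variable {S} {P Q : Matrix (Fin (n + 1)) (Fin (n + 1)) ℂ}

lemma AE (hP : S.IsP P) (i j : Fin (n + 1)) : S.A i * S.E j = P j i • S.E j := by
  rw [hP i, Finset.sum_mul, Finset.sum_eq_single j]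
  · simp [S.E_mul]
  · intro b _ hb
    simp [S.E_mul, hb]
  · simp

lemma P_rec (hP : S.IsP P) (i j l : Fin (n + 1)) :
    P l i * P l j = ∑ k, S.p i j k * P l k := by
  have h : (S.A i * S.A j) * S.E l = (∑ k, S.p i j k • S.A k) * S.E l := by rw [S.A_mul]
  rw [Matrix.mul_assoc, AE hP, Matrix.mul_smul, AE hP, Finset.sum_mul, smul_smul] at h
  simp only [Matrix.smul_mul, AE hP, smul_smul] at h
  rw [← Finset.sum_smul] at h
  rw [mul_comm]
  exact smul_left_injective ℂ (S.E_ne l) h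

lemma theta_ne (hn : 1 ≤ n) (hmet : S.Metric) (hP : S.IsP P) (hQ : S.IsQ Q)
    {j : Fin (n + 1)} (hj : j ≠ 0) :
    P j ⟨1, by omega⟩ ≠ P 0 ⟨1, by omega⟩ := by
  intro h1
  have hP0 : ∀ l, P l 0 = 1 := by
    intro l
    have := AE hP 0 l
    rw [S.A_zero, Matrix.one_mul] at this
    have h2 : (1 : ℂ) • S.E l = P l 0 • S.E l := by rw [one_smul]; exact this
    exact (smul_left_injective ℂ (S.E_ne l) h2).symm
  have key : ∀ m : ℕ, ∀ hm : m < n + 1, P j ⟨m, hm⟩ = P 0 ⟨m, hm⟩ := by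
    intro m
    induction m using Nat.strong_induction_on with
    | _ m ih =>
      intro hm
      rcases m with _ | m
      · have : (⟨0, hm⟩ : Fin (n + 1)) = 0 := rfl
        rw [this, hP0, hP0]
      · have ha := P_rec hP ⟨1, by omega⟩ ⟨m, by omega⟩ j
        have hb := P_rec hP ⟨1, by omega⟩ ⟨m, by omega⟩ 0
        rw [h1, ih m (by omega), hb] at ha
        rw [← Finset.add_sum_erase _ _ (Finset.mem_univ (⟨m + 1, hm⟩ : Fin (n + 1))),
          ← Finset.add_sum_erase _ _ (Finset.mem_univ (⟨m + 1, hm⟩ : Fin (n + 1)))] at ha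
        have hs : ∀ k ∈ Finset.univ.erase (⟨m + 1, hm⟩ : Fin (n + 1)),
            S.p ⟨1, by omega⟩ ⟨m, by omega⟩ k * P 0 k =
            S.p ⟨1, by omega⟩ ⟨m, by omega⟩ k * P j k := by
          intro k hk
          rcases lt_or_ge (k : ℕ) (m + 1) with h | h
          · rw [ih k h k.2]
          · have hne : (k : ℕ) ≠ m + 1 := by
              intro h'
              exact (Finset.mem_erase.1 hk).1 (Fin.ext h')
            rw [(hmet ⟨1, by omega⟩ ⟨m, by omega⟩ k).1 (by simp; omega)]
            simp
        rw [Finset.sum_congr rfl hs] at ha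
        have hne := (hmet ⟨1, by omega⟩ ⟨m, by omega⟩ ⟨m + 1, hm⟩).2 (by simp; omega)
        exact (mul_left_cancel₀ hne (add_right_cancel ha)).symm
  have gen : ∀ l, S.E j * S.E l =
      ((Fintype.card X : ℂ)⁻¹ * ∑ k, Q k j * P l k) • S.E l := by
    intro l
    conv_lhs => rw [hQ j]
    rw [Matrix.smul_mul, Finset.sum_mul]
    simp only [Matrix.smul_mul, AE hP, smul_smul]
    rw [← Finset.sum_smul, smul_smul]
  have g0 := gen 0
  have gj := gen j
  rw [S.E_mul, if_neg hj] at g0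
  rw [S.E_mul, if_pos rfl] at gj
  have hz := (smul_eq_zero.1 g0.symm).resolve_right (S.E_ne 0)
  have hPP : ∀ k, P j k = P 0 k := fun k => key k k.2
  simp only [hPP] at gj
  rw [hz, zero_smul] at gj
  exact S.E_ne j gj

lemma exists_poly (hn : 1 ≤ n) (hmet : S.Metric) (hP : S.IsP P) (hQ : S.IsQ Q) (m : ℕ) :
    m < n + 1 → ∃ (M : Matrix X X ℂ) (c : Fin (n + 1) → ℂ), c 0 ≠ 0 ∧
      (∀ j, M * S.E j = c j • S.E j) ∧ (∀ j : Fin (n + 1), j ≠ 0 → (j : ℕ) ≤ m → c j = 0) ∧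
      (∀ x y, M x y ≠ 0 → ∃ i : Fin (n + 1), (i : ℕ) ≤ m ∧ S.A i x y ≠ 0) := by
  induction m with
  | zero =>
    intro _
    refine ⟨1, fun _ => 1, one_ne_zero, by simp, ?_, ?_⟩
    · intro j hj hj'
      exact absurd (Fin.ext (Nat.le_zero.1 hj')) hj
    · intro x y h
      exact ⟨0, by simp, by rwa [S.A_zero]⟩
  | succ m ih =>
    intro hm
    obtain ⟨M, c, h0, hE, hc, hM⟩ := ih (by omega)
    refine ⟨S.A ⟨1, by omega⟩ * M - P ⟨m + 1, hm⟩ ⟨1, by omega⟩ • M,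
      fun j => (P j ⟨1, by omega⟩ - P ⟨m + 1, hm⟩ ⟨1, by omega⟩) * c j, ?_, ?_, ?_, ?_⟩
    · refine mul_ne_zero (sub_ne_zero.2 (theta_ne hn hmet hP hQ ?_).symm) h0
      intro h
      simpa using congrArg Fin.val h
    · intro j
      rw [Matrix.sub_mul, Matrix.mul_assoc, Matrix.smul_mul, hE, Matrix.mul_smul, AE hP,
        smul_smul, smul_smul, ← sub_smul]
      congr 1
      ring
    · intro j hj hjm
      rcases Nat.lt_or_ge m j with h | h
      · have : j = ⟨m + 1, hm⟩ := Fin.ext (by simp; omega)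
        simp [this]
      · simp [hc j hj h]
    · intro x y hxy
      by_cases h : M x y = 0
      · simp only [Matrix.sub_apply, Matrix.smul_apply, h, smul_zero, sub_zero,
          Matrix.mul_apply] at hxy
        obtain ⟨z, _, hz⟩ := Finset.exists_ne_zero_of_sum_ne_zero hxy
        obtain ⟨i, him, hi⟩ := hM z y (right_ne_zero_of_mul hz)
        obtain ⟨k, hk⟩ := A_exists S x y
        have := triangle S hmet (left_ne_zero_of_mul hz) hi hk
        exact ⟨k, by simp at this; omega, hk⟩
      · obtain ⟨i, him, hi⟩ := hM x y h
        exact ⟨i, by omega, hi⟩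

lemma P_last_ne [Nonempty X] (hP : S.IsP P) (hQ : S.IsQ Q) (i : Fin (n + 1)) : S.A i ≠ 0 := by
  intro hA
  have hPi : ∀ k, P k i = 0 := by
    intro k
    have := AE hP i k
    rw [hA, Matrix.zero_mul] at this
    exact (smul_eq_zero.1 this.symm).resolve_right (S.E_ne k)
  have hcard : (Fintype.card X : ℂ) ≠ 0 := by simp
  have hPQ : P * ((Fintype.card X : ℂ)⁻¹ • Q) = 1 := by
    ext l j
    have gen : S.E j * S.E l =
        ((Fintype.card X : ℂ)⁻¹ * ∑ k, Q k j * P l k) • S.E l := by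
      conv_lhs => rw [hQ j]
      rw [Matrix.smul_mul, Finset.sum_mul]
      simp only [Matrix.smul_mul, AE hP, smul_smul]
      rw [← Finset.sum_smul, smul_smul]
    have h2 : S.E j * S.E l = ((1 : Matrix (Fin (n + 1)) (Fin (n + 1)) ℂ) l j) • S.E l := by
      rw [S.E_mul, Matrix.one_apply]
      by_cases h : j = l
      · simp [h]
      · simp [h, Ne.symm h]
    rw [h2] at gen
    rw [smul_left_injective ℂ (S.E_ne l) gen, Matrix.mul_smul, Matrix.smul_apply,
      Matrix.mul_apply, smul_eq_mul]
    simp [mul_comm]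
  have hQP := mul_eq_one_comm.1 hPQ
  have := congrFun (congrFun hQP i) i
  rw [Matrix.mul_apply] at this
  simp [hPi] at this

lemma exists_far [Nonempty X] (hP : S.IsP P) (hQ : S.IsQ Q) (i : Fin (n + 1)) (y : X) :
    ∃ x, S.A i y x ≠ 0 := by
  by_contra! h
  have hcard : (Fintype.card X : ℂ) ≠ 0 := by simp
  have hrow : ∀ z, ∑ x, S.A i z x = P 0 i := by
    intro z
    have := congrFun (congrFun (AE hP i 0) z) z
    rw [S.E_zero, Matrix.mul_apply] at this
    simp only [Matrix.smul_apply, Matrix.of_apply, smul_eq_mul, mul_one,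
      ← Finset.sum_mul] at this
    exact mul_right_cancel₀ (inv_ne_zero hcard) this
  have h0 : P 0 i = 0 := by rw [← hrow y]; simp [h]
  apply P_last_ne hP hQ i
  ext z x
  have := hrow z
  rw [h0, Finset.sum_eq_zero_iff_of_nonneg (fun k _ => A_nonneg S i z k)] at this
  exact this x (Finset.mem_univ _)

lemma E_chi [Nonempty X] (hQ : S.IsQ Q) (Y : Finset X) (hY : Y.card ≠ 0) (i : Fin (n + 1))
    (h : macT Q (innerDist S Y) i = 0) :
    S.E i *ᵥ (fun x => if x ∈ Y then (1 : ℂ) else 0) = 0 := by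
  have hcard : (Fintype.card X : ℂ) ≠ 0 := by simp
  have hYc : (Y.card : ℂ) ≠ 0 := by exact_mod_cast hY
  have hsum : ∑ x ∈ Y, ∑ y ∈ Y, S.E i x y = 0 := by
    have h1 : ∑ x ∈ Y, ∑ y ∈ Y, S.E i x y =
        (Fintype.card X : ℂ)⁻¹ * Y.card * macT Q (innerDist S Y) i := by
      have e : ∀ x y, S.E i x y = (Fintype.card X : ℂ)⁻¹ * ∑ j, Q j i * S.A j x y := by
        intro x y
        have := congrFun (congrFun (hQ i) x) y
        rw [this]
        simp [Matrix.sum_apply]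
      simp only [e, macT, innerDist, ← Finset.mul_sum]
      rw [mul_assoc]
      congr 1
      rw [Finset.mul_sum]
      calc ∑ x ∈ Y, ∑ y ∈ Y, ∑ j, Q j i * S.A j x y
          = ∑ x ∈ Y, ∑ j, ∑ y ∈ Y, Q j i * S.A j x y := by
            refine Finset.sum_congr rfl fun x _ => Finset.sum_comm
        _ = ∑ j, ∑ x ∈ Y, ∑ y ∈ Y, Q j i * S.A j x y := Finset.sum_comm
        _ = _ := by
            refine Finset.sum_congr rfl fun j _ => ?_
            simp only [← Finset.mul_sum]
            field_simp
    rw [h1, h, mul_zero]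
  set χ : X → ℂ := fun x => if x ∈ Y then (1 : ℂ) else 0 with hχ
  have hst : star χ = χ := by
    ext x
    simp only [hχ, Pi.star_apply]
    split_ifs <;> simp
  have hd : star (S.E i *ᵥ χ) ⬝ᵥ (S.E i *ᵥ χ) = 0 := by
    rw [Matrix.star_mulVec, (S.E_herm i).eq, ← Matrix.dotProduct_mulVec, Matrix.mulVec_mulVec,
      S.E_mul, if_pos rfl, hst, ← hsum]
    simp [dotProduct, Matrix.mulVec, hχ, Finset.sum_ite_mem]
  exact dotProduct_star_self_eq_zero.1 hd

end helpers

/-- in a metric & cometric scheme, every nontrivial subset satisfies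
`w + w* ≥ n`. -/
theorem width_plus_dual_width {X : Type*} [Fintype X] [DecidableEq X]
    [Nonempty X] {n : ℕ} (hn : 1 ≤ n) (S : Scheme X n) (hsym : S.IsSym) (hmet : S.Metric)
    (q : Fin (n + 1) → Fin (n + 1) → Fin (n + 1) → ℂ) (hcom : S.Cometric q)
    (P Q : Matrix (Fin (n + 1)) (Fin (n + 1)) ℂ) (hP : S.IsP P) (hQ : S.IsQ Q) :
    ∀ (Y : Finset X), 1 < Y.card → Y.card < Fintype.card X →
      ∀ (w ws : Fin (n + 1)),
        IsGreatest {i : Fin (n + 1) | innerDist S Y i ≠ 0} w →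
        IsGreatest {i : Fin (n + 1) | macT Q (innerDist S Y) i ≠ 0} ws →
        n ≤ (w : ℕ) + (ws : ℕ) := by
  intro Y hY1 _ w ws hw hws
  have hcard : (Fintype.card X : ℂ) ≠ 0 := by simp
  have hYc : (Y.card : ℂ) ≠ 0 := by
    have : Y.card ≠ 0 := by omega
    exact_mod_cast this
  obtain ⟨y, hy⟩ : Y.Nonempty := Finset.card_pos.1 (by omega)
  obtain ⟨x, hx⟩ := exists_far hP hQ (Fin.last n) y
  obtain ⟨M, c, h0, hE, hc, hM⟩ := exists_poly hn hmet hP hQ ws ws.2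
  set χ : X → ℂ := fun x => if x ∈ Y then (1 : ℂ) else 0 with hχ
  have hMχ : M *ᵥ χ = c 0 • (S.E 0 *ᵥ χ) := by
    have h1 : M = ∑ j, c j • S.E j := by
      calc M = M * ∑ j, S.E j := by rw [S.E_sum, Matrix.mul_one]
        _ = _ := by rw [Finset.mul_sum]; exact Finset.sum_congr rfl fun j _ => hE j
    rw [h1, Matrix.sum_mulVec, Finset.sum_eq_single 0]
    · rw [Matrix.smul_mulVec]
    · intro j _ hj
      rw [Matrix.smul_mulVec]
      by_cases hjw : (j : ℕ) ≤ ws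
      · rw [hc j hj hjw, zero_smul]
      · rw [E_chi hQ Y (by omega) j, smul_zero]
        by_contra hne
        exact hjw (hws.2 hne)
    · simp
  have hxne : (M *ᵥ χ) x ≠ 0 := by
    rw [hMχ, S.E_zero, Pi.smul_apply, smul_eq_mul]
    refine mul_ne_zero h0 ?_
    have : (((Fintype.card X : ℂ)⁻¹ • Matrix.of fun _ _ => (1 : ℂ)) *ᵥ χ) x
        = (Fintype.card X : ℂ)⁻¹ * Y.card := by
      simp [Matrix.mulVec, dotProduct, hχ, mul_comm]
    rw [this]
    exact mul_ne_zero (inv_ne_zero hcard) hYc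
  obtain ⟨y', _, hy'⟩ := Finset.exists_ne_zero_of_sum_ne_zero hxne
  have hyY : y' ∈ Y := by
    by_contra h
    simp [hχ, h] at hy'
  obtain ⟨i, hiw, hi⟩ := hM x y' (left_ne_zero_of_mul hy')
  obtain ⟨j, hj⟩ := A_exists S y y'
  have hjw : j ≤ w := by
    apply hw.2
    show innerDist S Y j ≠ 0
    refine mul_ne_zero (inv_ne_zero hYc) ?_
    intro h
    rw [Finset.sum_eq_zero_iff_of_nonneg
      (fun a _ => Finset.sum_nonneg fun b _ => A_nonneg S j a b)] at h
    have h2 := h y hy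
    rw [Finset.sum_eq_zero_iff_of_nonneg (fun b _ => A_nonneg S j y b)] at h2
    exact hj (h2 y' hyY)
  have hi' : S.A i y' x ≠ 0 := by
    rw [← hsym i]
    exact hi
  have := triangle S hmet hj hi' hx
  have hjw' : (j : ℕ) ≤ w := hjw
  simp at this
  omega

end AssocScheme
end

section
/- Let (X, R) be a symmetric association scheme with n classes that is cometric with respect to the ordering E_0, …, E_n of its primitive idempotents. Let Y ⊆ X be a code with 1 < |Y| < |X|, characteristic vector χ and dual distance δ*. Fix a base vertex x ∈ X, let E_ℓ*(x) be the diagonal matrix with (E_ℓ*(x))_{yy} = (A_ℓ)_{xy}, and set s_x = #{i ∈ {1,…,n} : E_i*(x) χ ≠ 0}. Then for every 0 ≤ ℓ ≤ n, the vector E_ℓ*(x) χ is a relative (δ* − s_x)-design with respect to x; that is, for every i with 1 ≤ i ≤ δ* − s_x there exists c ∈ ℂ with E_i (E_ℓ*(x) χ) = c · E_i x̂, where x̂ ∈ ℂ^X is the standard basis vector supported at x. -/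
open Matrix BigOperators
open scoped ComplexOrder

namespace AssocScheme

section helpers
variable {X : Type*} [Fintype X] [DecidableEq X] {n : ℕ}

lemma rd_E_symm (S : Scheme X n) (hsym : S.IsSym)
    (Q : Matrix (Fin (n + 1)) (Fin (n + 1)) ℂ) (hQ : S.IsQ Q) (i : Fin (n + 1)) (y z : X) :
    S.E i y z = S.E i z y := by
  have h : ∀ j, S.A j y z = S.A j z y := fun j => by
    conv_lhs => rw [← hsym j]
    rfl
  rw [hQ i]
  simp [Matrix.sum_apply, h]

lemma rd_E_star (S : Scheme X n) (i : Fin (n + 1)) (y z : X) :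
    star (S.E i y z) = S.E i z y := (S.E_herm i).apply z y

lemma rd_triple (S : Scheme X n) (q : Fin (n + 1) → Fin (n + 1) → Fin (n + 1) → ℂ)
    (hq : S.IsKrein q) (hs : ∀ i y z, S.E i y z = S.E i z y)
    (i j k : Fin (n + 1)) (h0 : q i j k = 0) (x : X) :
    S.E i * Matrix.diagonal (S.E j x) * S.E k = 0 := by
  set M : X → Matrix X X ℂ := fun x => S.E i * Matrix.diagonal (S.E j x) * S.E k with hM
  have htr : ∀ x, (M x * (M x)ᴴ).trace =
      ∑ z, ∑ y, S.E i z y * S.E j x y * S.E k y z * S.E j z x := by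
    intro x
    have h1 : (M x * (M x)ᴴ).trace =
        (S.E i * Matrix.diagonal (S.E j x) * S.E k * (Matrix.diagonal (S.E j x))ᴴ).trace := by
      have e1 : M x * (M x)ᴴ = S.E i * Matrix.diagonal (S.E j x) * (S.E k * S.E k) *
          (Matrix.diagonal (S.E j x))ᴴ * S.E i := by
        simp only [hM, Matrix.conjTranspose_mul, (S.E_herm _).eq, Matrix.mul_assoc]
      rw [e1, Matrix.trace_mul_comm, S.E_mul, if_pos rfl]
      simp only [← Matrix.mul_assoc]
      rw [S.E_mul, if_pos rfl]
    rw [h1, Matrix.diagonal_conjTranspose]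
    simp only [Matrix.trace, Matrix.diag, Matrix.mul_diagonal, Matrix.mul_apply (N := S.E k)]
    refine Finset.sum_congr rfl fun z _ => ?_
    rw [Finset.sum_mul]
    refine Finset.sum_congr rfl fun y _ => ?_
    rw [Pi.star_apply, rd_E_star]
  have hsum : ∑ x, (M x * (M x)ᴴ).trace = 0 := by
    simp only [htr]
    have hj : ∀ z y, ∑ x, S.E j z x * S.E j x y = S.E j z y := by
      intro z y
      rw [← Matrix.mul_apply, S.E_mul, if_pos rfl]
    have e2 : ∑ x, ∑ z, ∑ y, S.E i z y * S.E j x y * S.E k y z * S.E j z x =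
        (Matrix.hadamard (S.E i) (S.E j) * S.E k).trace := by
      rw [Finset.sum_comm]
      simp only [Matrix.trace, Matrix.diag, Matrix.mul_apply, Matrix.hadamard_apply]
      refine Finset.sum_congr rfl fun z _ => ?_
      rw [Finset.sum_comm]
      refine Finset.sum_congr rfl fun y _ => ?_
      rw [← hj z y, Finset.mul_sum, Finset.sum_mul]
      refine Finset.sum_congr rfl fun x _ => ?_
      ring
    rw [e2, hq i j]
    simp [Matrix.sum_mul, S.E_mul, h0]
  have hz := (Finset.sum_eq_zero_iff_of_nonneg
    (fun x _ => (Matrix.posSemidef_self_mul_conjTranspose (M x)).trace_nonneg)).1 hsum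
    x (Finset.mem_univ x)
  exact Matrix.trace_mul_conjTranspose_self_eq_zero_iff.1 hz

lemma rd_A_mem (S : Scheme X n) (k : Fin (n + 1)) :
    S.A k ∈ Submodule.span ℂ (Set.range S.E) := by
  have hli : LinearIndependent ℂ S.E := by
    rw [Fintype.linearIndependent_iff]
    intro g hg i
    have := congrArg (fun M => M * S.E i) hg
    simp only [Matrix.sum_mul, Matrix.smul_mul, S.E_mul, Matrix.zero_mul] at this
    simpa [S.E_ne i] using this
  have hle : Submodule.span ℂ (Set.range S.E) ≤ Submodule.span ℂ (Set.range S.A) := by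
    rw [Submodule.span_le]
    rintro _ ⟨i, rfl⟩
    exact S.E_span i
  have h1 := finrank_span_eq_card hli
  have h2 := finrank_range_le_card (R := ℂ) S.A
  have heq := Submodule.eq_of_le_of_finrank_le hle (by
    rw [h1]; exact h2)
  rw [heq]
  exact Submodule.subset_span ⟨k, rfl⟩

lemma rd_E_sep (S : Scheme X n) (q : Fin (n + 1) → Fin (n + 1) → Fin (n + 1) → ℂ)
    [Nonempty X]
    (hcom : S.Cometric q) (e : Fin (n + 1)) (he : (e : ℕ) = 1) (x y z : X)
    (h : S.E e x y = S.E e x z) (m : ℕ) :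
    ∀ j : Fin (n + 1), (j : ℕ) = m → S.E j x y = S.E j x z := by
  have hc : (Fintype.card X : ℂ) ≠ 0 := by simp
  induction m using Nat.strong_induction_on with
  | _ m ih =>
    intro j hj
    rcases Nat.eq_zero_or_pos m with h0 | hpos
    · have : j = 0 := Fin.ext (by simp [hj, h0])
      subst this
      simp [S.E_zero]
    · let j' : Fin (n + 1) := ⟨m - 1, by omega⟩
      have hj' : S.E j' x y = S.E j' x z := ih (m - 1) (by omega) j' rfl
      have key : ∀ w, (Fintype.card X : ℂ) * (S.E e x w * S.E j' x w) =
          q e j' j * S.E j x w + ∑ k ∈ Finset.univ.erase j, q e j' k * S.E k x w := by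
        intro w
        have := congrFun (congrFun (hcom.1 e j') x) w
        rw [Matrix.hadamard_apply] at this
        rw [this, Finset.add_sum_erase _ (fun k => q e j' k * S.E k x w) (Finset.mem_univ j)]
        simp [Matrix.sum_apply, hc]
      have hrest : ∑ k ∈ Finset.univ.erase j, q e j' k * S.E k x y =
          ∑ k ∈ Finset.univ.erase j, q e j' k * S.E k x z := by
        refine Finset.sum_congr rfl fun k hk => ?_
        have hkj : (k : ℕ) ≠ j := fun hh => (Finset.mem_erase.1 hk).1 (Fin.ext hh)
        rcases lt_or_ge (k : ℕ) m with hlt | hge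
        · rw [ih k hlt k rfl]
        · have : q e j' k = 0 := (hcom.2 e j' k).1 (by
            show (e : ℕ) + (m - 1) < k
            omega)
          simp [this]
      have hne : q e j' j ≠ 0 := (hcom.2 e j' j).2 (by
            show (j : ℕ) = (e : ℕ) + (m - 1)
            omega)
      have k1 := key y
      rw [h, hj', key z, hrest] at k1
      exact (mul_left_cancel₀ hne (add_right_cancel k1)).symm

lemma rd_A_sep (S : Scheme X n) (q : Fin (n + 1) → Fin (n + 1) → Fin (n + 1) → ℂ)
    [Nonempty X]
    (hcom : S.Cometric q) (e : Fin (n + 1)) (he : (e : ℕ) = 1) (x y z : X)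
    (h : S.E e x y = S.E e x z) (k : Fin (n + 1)) : S.A k x y = S.A k x z := by
  have hmem := rd_A_mem S k
  generalize S.A k = B at hmem ⊢
  induction hmem using Submodule.span_induction with
  | mem M hM =>
    obtain ⟨j, rfl⟩ := hM
    exact rd_E_sep S q hcom e he x y z h j j rfl
  | zero => rfl
  | add M N _ _ hM hN => simp [hM, hN]
  | smul c M _ hM => simp [hM]

/-- every point lies in exactly one class relative to `x`. -/
lemma rd_A_class (S : Scheme X n) (x y : X) :
    ∃ k, S.A k x y = 1 ∧ ∀ h, h ≠ k → S.A h x y = 0 := by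
  classical
  have h1 : ∑ i, S.A i x y = 1 := by
    have := congrFun (congrFun S.A_sum x) y
    simpa [Matrix.sum_apply] using this
  have h2 : ∀ i, S.A i x y = if S.A i x y = 1 then 1 else 0 := by
    intro i
    rcases S.A_zeroOne i x y with h | h <;> simp [h]
  have h3 : (Finset.univ.filter (fun i => S.A i x y = 1)).card = 1 := by
    rw [Finset.sum_congr rfl (fun i _ => h2 i), Finset.sum_boole] at h1
    exact_mod_cast h1
  obtain ⟨k, hk⟩ := Finset.card_eq_one.1 h3
  refine ⟨k, ?_, ?_⟩
  · have : k ∈ ({k} : Finset (Fin (n+1))) := by simp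
    rw [← hk] at this
    simpa using this
  · intro h hne
    rcases S.A_zeroOne h x y with h' | h'
    · exact h'
    · exfalso
      have : h ∈ (Finset.univ.filter (fun i => S.A i x y = 1)) := by simp [h']
      rw [hk] at this
      exact hne (by simpa using this)

lemma rd_E_class (S : Scheme X n) (Q : Matrix (Fin (n + 1)) (Fin (n + 1)) ℂ) (hQ : S.IsQ Q)
    (x y : X) (k i : Fin (n + 1)) (hk : S.A k x y = 1) :
    S.E i x y = (Fintype.card X : ℂ)⁻¹ * Q k i := by
  obtain ⟨k', h1, h2⟩ := rd_A_class S x y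
  have hkk : k = k' := by
    by_contra hne
    rw [h2 k hne] at hk
    exact zero_ne_one hk
  subst hkk
  rw [hQ i]
  simp only [Matrix.smul_apply, Matrix.sum_apply, smul_eq_mul]
  rw [Finset.sum_eq_single k (fun h _ hne => by simp [h2 h hne]) (by simp)]
  simp [h1]

/-- the span of the first rows of idempotents. -/
def rdV (S : Scheme X n) (x : X) (d : ℕ) : Submodule ℂ (X → ℂ) :=
  Submodule.span ℂ {w | ∃ j : Fin (n + 1), (j : ℕ) ≤ d ∧ w = S.E j x}

lemma rdV_mono (S : Scheme X n) (x : X) {d d' : ℕ} (h : d ≤ d') : rdV S x d ≤ rdV S x d' := by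
  refine Submodule.span_mono ?_
  rintro w ⟨j, hj, rfl⟩
  exact ⟨j, hj.trans h, rfl⟩

lemma rdV_one [Nonempty X] (S : Scheme X n) (x : X) : (1 : X → ℂ) ∈ rdV S x 0 := by
  have hc : (Fintype.card X : ℂ) ≠ 0 := by simp
  have : (1 : X → ℂ) = (Fintype.card X : ℂ) • S.E 0 x := by
    ext y
    simp [S.E_zero]
  rw [this]
  exact Submodule.smul_mem _ _ (Submodule.subset_span ⟨0, by simp, rfl⟩)

lemma rdV_mul (S : Scheme X n) (q : Fin (n + 1) → Fin (n + 1) → Fin (n + 1) → ℂ)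
    (hcom : S.Cometric q) (e : Fin (n + 1)) (he : (e : ℕ) = 1) (x : X) (d : ℕ)
    (w : X → ℂ) (hw : w ∈ rdV S x d) : (S.E e x) * w ∈ rdV S x (d + 1) := by
  induction hw using Submodule.span_induction with
  | mem w hw =>
    obtain ⟨j, hj, rfl⟩ := hw
    have : S.E e x * S.E j x = (Fintype.card X : ℂ)⁻¹ • ∑ k, q e j k • S.E k x := by
      ext y
      have := congrFun (congrFun (hcom.1 e j) x) y
      rw [Matrix.hadamard_apply] at this
      rw [Pi.mul_apply, this]
      simp [Matrix.sum_apply]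
    rw [this]
    refine Submodule.smul_mem _ _ (Submodule.sum_mem _ fun k _ => ?_)
    by_cases hk : (k : ℕ) ≤ d + 1
    · exact Submodule.smul_mem _ _ (Submodule.subset_span ⟨k, hk, rfl⟩)
    · rw [(hcom.2 e j k).1 (by omega), zero_smul]
      exact Submodule.zero_mem _
  | zero => simp
  | add M N _ _ hM hN => rw [mul_add]; exact Submodule.add_mem _ hM hN
  | smul c M _ hM => rw [mul_smul_comm]; exact Submodule.smul_mem _ _ hM

lemma rdV_prod [Nonempty X] (S : Scheme X n) (q : Fin (n + 1) → Fin (n + 1) → Fin (n + 1) → ℂ)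
    (hcom : S.Cometric q) (e : Fin (n + 1)) (he : (e : ℕ) = 1) (x : X)
    (θ : Fin (n + 1) → ℂ) (T : Finset (Fin (n + 1))) :
    (∏ k ∈ T, (S.E e x - θ k • (1 : X → ℂ))) ∈ rdV S x T.card := by
  classical
  induction T using Finset.induction_on with
  | empty => simpa using rdV_one S x
  | insert a T ha ih =>
    rw [Finset.prod_insert ha, Finset.card_insert_of_notMem ha, sub_mul, smul_mul_assoc, one_mul]
    exact Submodule.sub_mem _ (rdV_mul S q hcom e he x _ _ ih)
      (Submodule.smul_mem _ _ (rdV_mono S x (Nat.le_succ _) ih))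

lemma rd_dual (S : Scheme X n) (Q : Matrix (Fin (n + 1)) (Fin (n + 1)) ℂ) (hQ : S.IsQ Q)
    [Nonempty X] (Y : Finset X) (hY : Y.card ≠ 0)
    (χ : X → ℂ) (hχ : ∀ y, χ y = if y ∈ Y then 1 else 0) (k : Fin (n + 1))
    (h0 : macT Q (innerDist S Y) k = 0) : (S.E k).mulVec χ = 0 := by
  have hc : (Fintype.card X : ℂ) ≠ 0 := by simp
  have hYc : (Y.card : ℂ) ≠ 0 := by exact_mod_cast hY
  have h1 : ∑ y ∈ Y, ∑ z ∈ Y, S.E k y z = 0 := by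
    have e1 : macT Q (innerDist S Y) k =
        (Y.card : ℂ)⁻¹ * ∑ y ∈ Y, ∑ z ∈ Y, ∑ j, Q j k * S.A j y z := by
      have : ∑ y ∈ Y, ∑ z ∈ Y, ∑ j, Q j k * S.A j y z =
          ∑ j, ∑ y ∈ Y, ∑ z ∈ Y, Q j k * S.A j y z := by
        rw [Finset.sum_comm]
        rw [Finset.sum_congr rfl fun z _ => Finset.sum_comm]
        rw [Finset.sum_comm]
        exact Finset.sum_congr rfl fun j _ => Finset.sum_comm
      rw [this, Finset.mul_sum]
      refine Finset.sum_congr rfl fun j _ => ?_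
      simp only [innerDist, ← Finset.mul_sum]
      ring
    rw [e1] at h0
    have h2 := (mul_eq_zero.1 h0).resolve_left (inv_ne_zero hYc)
    have e3 : ∀ y z, S.E k y z = (Fintype.card X : ℂ)⁻¹ * ∑ j, Q j k * S.A j y z := by
      intro y z
      rw [hQ k]
      simp [Matrix.sum_apply]
    simp only [e3, ← Finset.mul_sum, h2, mul_zero]
  have hstar : star χ = χ := by
    ext y
    simp only [Pi.star_apply, hχ]
    split_ifs <;> simp
  have h4 : star ((S.E k).mulVec χ) ⬝ᵥ (S.E k).mulVec χ = 0 := by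
    rw [Matrix.star_mulVec, (S.E_herm k).eq, hstar, ← Matrix.dotProduct_mulVec,
      Matrix.mulVec_mulVec, S.E_mul, if_pos rfl, ← h1]
    simp [dotProduct, Matrix.mulVec, hχ]
  exact dotProduct_star_self_eq_zero.1 h4

lemma rd_main (S : Scheme X n) (q : Fin (n + 1) → Fin (n + 1) → Fin (n + 1) → ℂ)
    (hcom : S.Cometric q) (hs : ∀ i y z, S.E i y z = S.E i z y) [Nonempty X]
    (χ : X → ℂ) (δ : ℕ) (hδ : ∀ k : Fin (n + 1), k ≠ 0 → (k : ℕ) < δ → (S.E k).mulVec χ = 0)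
    (x : X) (i : Fin (n + 1)) (d : ℕ) (hd : (i : ℕ) + d < δ) (w : X → ℂ)
    (hw : w ∈ rdV S x d) :
    ∃ c : ℂ, (S.E i).mulVec (w * χ) = c • (S.E i).mulVec (Pi.single x 1) := by
  induction hw using Submodule.span_induction with
  | mem w hw =>
    obtain ⟨j, hj, rfl⟩ := hw
    have hχs : χ = ∑ k, (S.E k).mulVec χ := by
      rw [← Matrix.sum_mulVec, S.E_sum, Matrix.one_mulVec]
    have hdg : ∀ v : X → ℂ, (S.E i).mulVec (S.E j x * v) =
        (S.E i * Matrix.diagonal (S.E j x)).mulVec v := by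
      intro v
      rw [← Matrix.mulVec_mulVec]
      congr 1
      ext y
      simp [Matrix.mulVec_diagonal]
    have h1 : (S.E i).mulVec (S.E j x * χ) =
        (S.E i * Matrix.diagonal (S.E j x)).mulVec ((S.E 0).mulVec χ) := by
      rw [hdg]
      conv_lhs => rw [hχs]
      rw [Matrix.mulVec_sum]
      refine Finset.sum_eq_single 0 (fun k _ hk => ?_) (by simp)
      by_cases hlt : (k : ℕ) < δ
      · rw [hδ k hk hlt, Matrix.mulVec_zero]
      · rw [Matrix.mulVec_mulVec, rd_triple S q hcom.1 hs i j k ((hcom.2 i j k).1 (by omega)) x,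
          Matrix.zero_mulVec]
    obtain ⟨c0, hc0⟩ : ∃ c0 : ℂ, (S.E 0).mulVec χ = c0 • (1 : X → ℂ) := by
      refine ⟨(Fintype.card X : ℂ)⁻¹ * ∑ y, χ y, ?_⟩
      ext y
      simp [S.E_zero, Matrix.mulVec, dotProduct, Finset.mul_sum]
    have h2 : S.E j x * (1 : X → ℂ) = (S.E j).mulVec (Pi.single x 1) := by
      ext y
      simp [hs j x y]
    rw [h1, hc0, Matrix.mulVec_smul, ← hdg, h2, Matrix.mulVec_mulVec, S.E_mul]
    split_ifs with hij
    · exact ⟨c0, rfl⟩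
    · exact ⟨0, by rw [Matrix.zero_mulVec, smul_zero, zero_smul]⟩
  | zero => exact ⟨0, by simp⟩
  | add M N _ _ hM hN =>
    obtain ⟨a, ha⟩ := hM
    obtain ⟨b, hb⟩ := hN
    exact ⟨a + b, by rw [add_mul, Matrix.mulVec_add, ha, hb, add_smul]⟩
  | smul c M _ hM =>
    obtain ⟨a, ha⟩ := hM
    exact ⟨c * a, by rw [smul_mul_assoc, Matrix.mulVec_smul, ha, smul_smul]⟩

end helpers


/-- Delsarte; Tanaka: in a cometric scheme, for a code `Y` with dual
distance `δ*` and a base vertex `x`, each vector `E_ℓ*(x) χ` is a relative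
`(δ* − s_x)`-design with respect to `x`. -/
theorem relative_design_assmus_mattson {X : Type*} [Fintype X] [DecidableEq X]
    [Nonempty X] {n : ℕ} (hn : 1 ≤ n) (S : Scheme X n) (hsym : S.IsSym)
    (q : Fin (n + 1) → Fin (n + 1) → Fin (n + 1) → ℂ) (hcom : S.Cometric q)
    (Q : Matrix (Fin (n + 1)) (Fin (n + 1)) ℂ) (hQ : S.IsQ Q)
    (Y : Finset X) (hY1 : 1 < Y.card) (hY2 : Y.card < Fintype.card X)
    (χ : X → ℂ) (hχ : ∀ y, χ y = if y ∈ Y then 1 else 0)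
    (δs : Fin (n + 1))
    (hδs : IsLeast {i : Fin (n + 1) | i ≠ 0 ∧ macT Q (innerDist S Y) i ≠ 0} δs)
    (x : X)
    (Estar : Fin (n + 1) → Matrix X X ℂ)
    (hEstar : ∀ ℓ, Estar ℓ = Matrix.diagonal (fun y => S.A ℓ x y))
    (sx : ℕ)
    (hsx : sx = Nat.card {i : Fin (n + 1) | i ≠ 0 ∧ (Estar i).mulVec χ ≠ 0}) :
    ∀ (ℓ : Fin (n + 1)) (i : Fin (n + 1)), 1 ≤ (i : ℕ) → (i : ℕ) ≤ (δs : ℕ) - sx →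
      ∃ c : ℂ, (S.E i).mulVec ((Estar ℓ).mulVec χ) = c • (S.E i).mulVec (Pi.single x 1) := by
  classical
  intro ℓ i hi1 hi2
  have hs := rd_E_symm S hsym Q hQ
  have hEχ : ∀ (k : Fin (n + 1)) (y : X), (Estar k).mulVec χ y = S.A k x y * χ y := by
    intro k y
    rw [hEstar, Matrix.mulVec_diagonal]
  have hA0 : ∀ y, S.A 0 x y = if x = y then 1 else 0 := by
    intro y
    rw [S.A_zero, Matrix.one_apply]
  by_cases hℓ0 : ℓ = 0
  · subst hℓ0
    refine ⟨χ x, ?_⟩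
    rw [← Matrix.mulVec_smul]
    congr 1
    ext y
    rw [hEχ, hA0]
    by_cases hxy : x = y
    · subst hxy; simp
    · simp [hxy, Ne.symm hxy]
  by_cases hℓ : (Estar ℓ).mulVec χ = 0
  · exact ⟨0, by simp [hℓ]⟩
  set T : Finset (Fin (n + 1)) :=
    Finset.univ.filter (fun i => i ≠ 0 ∧ (Estar i).mulVec χ ≠ 0) with hT
  have hTc : sx = T.card := by
    rw [hsx, Nat.card_eq_fintype_card, hT, ← Set.toFinset_card]
    congr 1
    ext k
    simp
  have hℓT : ℓ ∈ T := by simp [hT, hℓ0, hℓ]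
  have hδ : ∀ k : Fin (n + 1), k ≠ 0 → (k : ℕ) < (δs : ℕ) → (S.E k).mulVec χ = 0 := by
    intro k hk hlt
    refine rd_dual S Q hQ Y (by omega) χ hχ k ?_
    by_contra hne
    have : δs ≤ k := hδs.2 ⟨hk, hne⟩
    exact absurd (Fin.le_def.1 this) (by omega)
  let e : Fin (n + 1) := ⟨1, by omega⟩
  have he : (e : ℕ) = 1 := rfl
  let θ : Fin (n + 1) → ℂ := fun k => (Fintype.card X : ℂ)⁻¹ * Q k e
  have hθ : ∀ k y, S.A k x y = 1 → S.E e x y = θ k := fun k y h => rd_E_class S Q hQ x y k e h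
  set f : X → ℂ := ∏ k ∈ T.erase ℓ, (S.E e x - θ k • (1 : X → ℂ)) with hf
  have hfV : f ∈ rdV S x (T.erase ℓ).card := rdV_prod S q hcom e he x θ _
  have hcard : (T.erase ℓ).card + 1 = T.card := Finset.card_erase_add_one hℓT
  obtain ⟨c, hc⟩ := rd_main S q hcom hs χ δs hδ x i _ (by omega) f hfV
  have hfy : ∀ y, f y = ∏ k ∈ T.erase ℓ, (S.E e x y - θ k) := by
    intro y
    simp [hf, Finset.prod_apply]
  have hrep : ∀ k, (Estar k).mulVec χ ≠ 0 → ∃ y, S.A k x y = 1 := by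
    intro k hk
    obtain ⟨y, hy⟩ := Function.ne_iff.1 hk
    rw [hEχ] at hy
    refine ⟨y, (S.A_zeroOne k x y).resolve_left fun h => hy (by simp [h])⟩
  have huniq : ∀ y k h, S.A k x y = 1 → S.A h x y = 1 → k = h := by
    intro y k h hk hh
    obtain ⟨m, _, hm⟩ := rd_A_class S x y
    have : ∀ k, S.A k x y = 1 → k = m := fun k hk => by
      by_contra hne
      rw [hm k hne] at hk
      exact zero_ne_one hk
    rw [this k hk, this h hh]
  set g : ℂ := ∏ k ∈ T.erase ℓ, (θ ℓ - θ k) with hg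
  have hg0 : g ≠ 0 := by
    rw [hg, Finset.prod_ne_zero_iff]
    intro k hk h0
    obtain ⟨hkℓ, hkT⟩ := Finset.mem_erase.1 hk
    obtain ⟨y, hy⟩ := hrep ℓ hℓ
    obtain ⟨z, hz⟩ := hrep k (Finset.mem_filter.1 hkT).2.2
    have hyz : S.E e x y = S.E e x z := by
      rw [hθ ℓ y hy, hθ k z hz]
      exact sub_eq_zero.1 h0
    have := rd_A_sep S q hcom e he x y z hyz k
    rw [hz] at this
    exact hkℓ (huniq y k ℓ this hy)
  have hdec : f * χ = g • (Estar ℓ).mulVec χ + (f x * χ x) • (Pi.single x 1 : X → ℂ) := by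
    ext y
    obtain ⟨m, hm1, hm2⟩ := rd_A_class S x y
    simp only [Pi.mul_apply, Pi.add_apply, Pi.smul_apply, smul_eq_mul, hEχ]
    by_cases hxy : x = y
    · subst hxy
      have h0 : S.A ℓ x x = 0 := by
        refine (S.A_zeroOne ℓ x x).resolve_right fun h => ?_
        exact hℓ0 (huniq x ℓ 0 h (by simp [hA0]))
      simp [h0]
    · rw [Pi.single_eq_of_ne (Ne.symm hxy), mul_zero, add_zero]
      by_cases hmℓ : m = ℓ
      · subst hmℓ
        rw [hm1, one_mul, hfy, hθ m y hm1]
      · rw [hm2 ℓ (Ne.symm hmℓ)]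
        by_cases hmT : m ∈ T
        · have : f y = 0 := by
            rw [hfy]
            refine Finset.prod_eq_zero (Finset.mem_erase.2 ⟨hmℓ, hmT⟩) ?_
            rw [hθ m y hm1, sub_self]
          simp [this]
        · have hm0 : m ≠ 0 := by
            intro h
            subst h
            rw [hA0, if_neg hxy] at hm1
            exact zero_ne_one hm1
          have : (Estar m).mulVec χ = 0 := by
            by_contra hne
            exact hmT (by simp [hT, hm0, hne])
          have h1 := congrFun this y
          rw [hEχ, hm1, one_mul] at h1
          simp [h1]
  rw [hdec, Matrix.mulVec_add, Matrix.mulVec_smul, Matrix.mulVec_smul] at hc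
  refine ⟨g⁻¹ * (c - f x * χ x), ?_⟩
  rw [mul_smul, sub_smul, ← hc, add_sub_cancel_right, smul_smul, inv_mul_cancel₀ hg0, one_smul]

end AssocScheme
end
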